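/- Let v : ℝ → ℝ be twice continuously differentiable with v''(x) + f(v(x)) = 0 and 0 < v(x) < 1 for all x ≥ 0, and suppose v(0) > β. Then for all x ≥ 0 one has (1/2)·v'(x)² + F(v(x)) = F(1) and v'(x) > 0; in particular v is strictly increasing on [0,∞) and v(x) → 1 as x → ∞. -/

import Mathlib

open Set Filter Topology

/-- The primitive `F(s) = ∫₀^s f(r) dr`. -/
noncomputable def F (f : ℝ → ℝ) (s : ℝ) : ℝ := ∫ r in (0:ℝ)..s, f r

/-- Bistable nonlinearity with balanced-positive integral. -/
def Bistable (f : ℝ → ℝ) (a : ℝ) : Prop :=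
  ContDiff ℝ 1 f ∧ 0 < a ∧ a < 1 ∧
  f 0 = 0 ∧ f a = 0 ∧ f 1 = 0 ∧
  (∀ s, 0 < s → s < a → f s < 0) ∧
  (∀ s, a < s → s < 1 → 0 < f s) ∧
  deriv f 0 < 0 ∧ 0 < deriv f a ∧ deriv f 1 < 0 ∧
  0 < ∫ s in (0:ℝ)..(1:ℝ), f s


theorem hasDerivAt_F {f : ℝ → ℝ} (hf : Continuous f) (s : ℝ) : HasDerivAt (F f) (f s) s :=
  hf.integral_hasStrictDerivAt 0 s |>.hasDerivAt

/-- If a function and its derivative both converge at infinity, the derivative tends to `0`. -/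
theorem eq_zero_of_tendsto_of_tendsto_deriv {g g' : ℝ → ℝ} {L c : ℝ}
    (hg : ∀ x, HasDerivAt g (g' x) x) (hL : Tendsto g atTop (𝓝 L))
    (hc : Tendsto g' atTop (𝓝 c)) : c = 0 := by
  have hmvt : ∀ x : ℝ, ∃ y ∈ Ioo x (x + 1), g' y = g (x + 1) - g x := by
    intro x
    obtain ⟨y, hy, h⟩ := exists_hasDerivAt_eq_slope g g' (lt_add_one x)
      (fun z _ => (hg z).continuousAt.continuousWithinAt) (fun z _ => hg z)
    exact ⟨y, hy, by simpa using h⟩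
  choose y hy hgy using hmvt
  have hy_top : Tendsto y atTop atTop := tendsto_atTop_mono (fun x => (hy x).1.le) tendsto_id
  have hdiff : Tendsto (fun x => g (x + 1) - g x) atTop (𝓝 (L - L)) :=
    (hL.comp (tendsto_atTop_add_const_right _ 1 tendsto_id)).sub hL
  rw [sub_self] at hdiff
  exact tendsto_nhds_unique (hc.comp hy_top) (hdiff.congr fun x => (hgy x).symm)

namespace Bistable

variable {f : ℝ → ℝ} {a β : ℝ}

theorem continuous (hf : Bistable f a) : Continuous f := hf.1.continuous

theorem strictMonoOn_F (hf : Bistable f a) : StrictMonoOn (F f) (Icc a 1) := by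
  refine strictMonoOn_of_deriv_pos (convex_Icc a 1)
    (fun s _ => (hasDerivAt_F hf.continuous s).continuousAt.continuousWithinAt) fun s hs => ?_
  rw [interior_Icc] at hs
  rw [(hasDerivAt_F hf.continuous s).deriv]
  exact hf.2.2.2.2.2.2.2.1 s hs.1 hs.2

theorem antitoneOn_F (hf : Bistable f a) : AntitoneOn (F f) (Icc 0 a) := by
  refine antitoneOn_of_deriv_nonpos (convex_Icc 0 a)
    (fun s _ => (hasDerivAt_F hf.continuous s).continuousAt.continuousWithinAt)
    (fun s _ => (hasDerivAt_F hf.continuous s).differentiableAt.differentiableWithinAt)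
    fun s hs => ?_
  rw [interior_Icc] at hs
  rw [(hasDerivAt_F hf.continuous s).deriv]
  exact (hf.2.2.2.2.2.2.1 s hs.1 hs.2).le

theorem F_pos_of_lt (hf : Bistable f a) (hβ : a < β ∧ β < 1 ∧ F f β = 0) {s : ℝ}
    (hs : β < s) (hs1 : s ≤ 1) : 0 < F f s := by
  rw [← hβ.2.2]
  exact hf.strictMonoOn_F ⟨hβ.1.le, hβ.2.1.le⟩ ⟨hβ.1.le.trans hs.le, hs1⟩ hs

theorem lt_of_F_pos (hf : Bistable f a) (hβ : a < β ∧ β < 1 ∧ F f β = 0) {s : ℝ}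
    (hs : 0 ≤ s) (hFs : 0 < F f s) : β < s := by
  by_contra! hsβ
  rcases le_total s a with hsa | has
  · have h := hf.antitoneOn_F ⟨le_rfl, hs.trans hsa⟩ ⟨hs, hsa⟩ hs
    have h0 : F f 0 = 0 := by simp [F]
    linarith
  · have h := hf.strictMonoOn_F.monotoneOn ⟨has, hsβ.trans hβ.2.1.le⟩
      ⟨hβ.1.le, hβ.2.1.le⟩ hsβ
    linarith [hβ.2.2]

/-- A stationary solution of positive energy with one-signed derivative can only converge to a
state in `[0, 1]` if that state is `1`, and its energy is then `F 1`. -/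
theorem limit_eq_one (hf : Bistable f a) (hβ : a < β ∧ β < 1 ∧ F f β = 0)
    {v w : ℝ → ℝ} {E L ε : ℝ} (hv : ∀ x, HasDerivAt v (w x) x)
    (hw : ∀ x, HasDerivAt w (deriv w x) x) (heq : ∀ x, 0 ≤ x → deriv w x + f (v x) = 0)
    (hE : 0 < E) (henergy : ∀ x, 0 ≤ x → (1/2) * (w x)^2 + F f (v x) = E)
    (hsign : ∀ᶠ x in atTop, w x = ε * |w x|)
    (hL : Tendsto v atTop (𝓝 L)) (hL0 : 0 ≤ L) (hL1 : L ≤ 1) :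
    L = 1 ∧ E = F f 1 := by
  have hFL : Tendsto (fun x => F f (v x)) atTop (𝓝 (F f L)) :=
    (hasDerivAt_F hf.continuous L).continuousAt.tendsto.comp hL
  have hw_sq : Tendsto (fun x => (w x)^2) atTop (𝓝 (2 * (E - F f L))) := by
    refine ((hFL.const_sub E).const_mul 2).congr' ?_
    filter_upwards [eventually_ge_atTop 0] with x hx
    linarith [henergy x hx]
  have hw_lim : Tendsto w atTop (𝓝 (ε * √(2 * (E - F f L)))) := by
    refine (hw_sq.sqrt.const_mul ε).congr' ?_
    filter_upwards [hsign] with x hx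
    rw [Real.sqrt_sq_eq_abs, ← hx]
  have hzero := eq_zero_of_tendsto_of_tendsto_deriv hv hL hw_lim
  rw [hzero] at hw_lim
  have hE_eq : E = F f L := by
    have h := tendsto_nhds_unique hw_sq (hw_lim.pow 2)
    linarith
  have hfL : Tendsto (deriv w) atTop (𝓝 (-f L)) := by
    refine ((hf.continuous.tendsto L).comp hL).neg.congr' ?_
    filter_upwards [eventually_ge_atTop 0] with x hx
    simp only [Function.comp_apply]
    linarith [heq x hx]
  have hf_zero := eq_zero_of_tendsto_of_tendsto_deriv hw hw_lim hfL
  have hβL := hf.lt_of_F_pos hβ hL0 (hE_eq ▸ hE)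
  have hL_eq : L = 1 := by
    by_contra hne
    have := hf.2.2.2.2.2.2.2.1 L (hβ.1.trans hβL) (lt_of_le_of_ne hL1 hne)
    linarith
  exact ⟨hL_eq, hL_eq ▸ hE_eq⟩

end Bistable

/-- Phase-plane fact: a stationary solution on a half-line staying in `(0,1)`
and starting above `β` lies on the stable manifold of `(1,0)`. -/
theorem stable_manifold_above_beta (f : ℝ → ℝ) (a β : ℝ) (hf : Bistable f a)
    (hβ : a < β ∧ β < 1 ∧ F f β = 0)
    (v : ℝ → ℝ) (hv : ContDiff ℝ 2 v)
    (heq : ∀ x : ℝ, 0 ≤ x → deriv (deriv v) x + f (v x) = 0)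
    (hbd : ∀ x : ℝ, 0 ≤ x → 0 < v x ∧ v x < 1)
    (h0 : β < v 0) :
    (∀ x : ℝ, 0 ≤ x → (1/2) * (deriv v x)^2 + F f (v x) = F f 1 ∧ 0 < deriv v x) ∧
    StrictMonoOn v (Ici 0) ∧ Tendsto v atTop (𝓝 1) := by
  obtain ⟨w, hw_def⟩ : ∃ w, w = deriv v := ⟨_, rfl⟩
  rw [← hw_def] at heq ⊢
  have hw1 : ContDiff ℝ 1 w := hw_def ▸ ((contDiff_succ_iff_deriv (n := 1)).1 hv).2.2
  have hvd : ∀ x, HasDerivAt v (w x) x := fun x =>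
    hw_def ▸ (hv.differentiable (by norm_num) x).hasDerivAt
  have hwd : ∀ x, HasDerivAt w (deriv w x) x := fun x =>
    (hw1.differentiable (by norm_num) x).hasDerivAt
  have hed : ∀ x, HasDerivAt (fun x => (1/2) * (w x)^2 + F f (v x))
      (w x * (deriv w x + f (v x))) x := by
    intro x
    convert! (((hwd x).pow 2).const_mul (1/2)).add
      ((hasDerivAt_F hf.continuous (v x)).comp x (hvd x)) using 1
    ring
  obtain ⟨E, hE_def⟩ : ∃ E, E = (1/2) * (w 0)^2 + F f (v 0) := ⟨_, rfl⟩
  have henergy : ∀ x, 0 ≤ x → (1/2) * (w x)^2 + F f (v x) = E := by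
    intro x hx
    rw [hE_def]
    refine constant_of_has_deriv_right_zero
      (f := fun x => (1/2) * (w x)^2 + F f (v x)) (a := 0) (b := x)
      (fun z _ => (hed z).continuousAt.continuousWithinAt) (fun z hz => ?_) x ⟨hx, le_rfl⟩
    simpa [heq z hz.1] using (hed z).hasDerivWithinAt (s := Ici z)
  have hE : 0 < E := by
    have := hf.F_pos_of_lt hβ h0 (hbd 0 le_rfl).2.le
    rw [hE_def]
    positivity
  have hpos : ∀ x, 0 ≤ x → 0 < w x := by
    by_contra! h
    obtain ⟨x₀, hx₀, hwx₀⟩ := h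
    have hneg : ∀ x, x₀ ≤ x → w x ≤ 0 := by
      intro x hx
      refine image_le_of_deriv_right_lt_deriv_boundary (f := w) (f' := deriv w)
        (B := fun _ => 0) (B' := fun _ => 0) (a := x₀) (b := x)
        (fun z _ => (hwd z).continuousAt.continuousWithinAt)
        (fun z _ => (hwd z).hasDerivWithinAt) hwx₀ (fun z => hasDerivAt_const z 0)
        (fun z hz hwz => ?_) ⟨hx, le_rfl⟩
      have hz0 : 0 ≤ z := hx₀.trans hz.1
      have hFz : 0 < F f (v z) := by
        have := henergy z hz0
        rw [hwz] at this
        linarith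
      have hβz := hf.lt_of_F_pos hβ (hbd z hz0).1.le hFz
      have := hf.2.2.2.2.2.2.2.1 (v z) (hβ.1.trans hβz) (hbd z hz0).2
      linarith [heq z hz0]
    have hanti : AntitoneOn v (Ici x₀) := by
      refine antitoneOn_of_deriv_nonpos (convex_Ici x₀) hv.continuous.continuousOn
        (fun z _ => (hvd z).differentiableAt.differentiableWithinAt) fun z hz => ?_
      rw [interior_Ici] at hz
      rw [(hvd z).deriv]
      exact hneg z (le_of_lt hz)
    obtain ⟨L, hL⟩ : ∃ L, Tendsto v atTop (𝓝 L) := by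
      have hm : Antitone fun x => v (max x₀ x) := fun x y hxy =>
        hanti (mem_Ici.2 (le_max_left _ _)) (mem_Ici.2 (le_max_left _ _))
        (max_le_max_left _ hxy)
      refine ⟨_, (tendsto_atTop_ciInf hm ⟨0, ?_⟩).congr' ?_⟩
      · rintro _ ⟨x, rfl⟩
        exact (hbd _ (hx₀.trans (le_max_left _ _))).1.le
      · filter_upwards [eventually_ge_atTop x₀] with x hx
        rw [max_eq_right hx]
    have hL0 : 0 ≤ L := ge_of_tendsto hL <| by
      filter_upwards [eventually_ge_atTop 0] with x hx using (hbd x hx).1.le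
    have hL1 : L ≤ v x₀ := le_of_tendsto hL <| by
      filter_upwards [eventually_ge_atTop x₀] with x hx using hanti self_mem_Ici hx hx
    have hlt := hL1.trans_lt (hbd x₀ hx₀).2
    refine hlt.ne (hf.limit_eq_one hβ (ε := -1) hvd hwd heq hE henergy ?_ hL hL0 hlt.le).1
    filter_upwards [eventually_ge_atTop x₀] with x hx
    rw [abs_of_nonpos (hneg x hx)]
    ring
  have hmono : StrictMonoOn v (Ici 0) := by
    refine strictMonoOn_of_deriv_pos (convex_Ici 0) hv.continuous.continuousOn fun z hz => ?_
    rw [interior_Ici] at hz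
    rw [(hvd z).deriv]
    exact hpos z (le_of_lt hz)
  obtain ⟨L, hL⟩ : ∃ L, Tendsto v atTop (𝓝 L) := by
    have hm : Monotone fun x => v (max 0 x) := fun x y hxy =>
      hmono.monotoneOn (mem_Ici.2 (le_max_left _ _)) (mem_Ici.2 (le_max_left _ _))
        (max_le_max_left _ hxy)
    refine ⟨_, (tendsto_atTop_ciSup hm ⟨1, ?_⟩).congr' ?_⟩
    · rintro _ ⟨x, rfl⟩
      exact (hbd _ (le_max_left _ _)).2.le
    · filter_upwards [eventually_ge_atTop 0] with x hx
      rw [max_eq_right hx]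
  have hL0 : 0 ≤ L := ge_of_tendsto hL <| by
    filter_upwards [eventually_ge_atTop 0] with x hx using (hbd x hx).1.le
  have hL1 : L ≤ 1 := le_of_tendsto hL <| by
    filter_upwards [eventually_ge_atTop 0] with x hx using (hbd x hx).2.le
  obtain ⟨rfl, hE1⟩ := hf.limit_eq_one hβ (ε := 1) hvd hwd heq hE henergy (by
    filter_upwards [eventually_ge_atTop 0] with x hx
    rw [abs_of_pos (hpos x hx), one_mul]) hL hL0 hL1
  exact ⟨fun x hx => ⟨hE1 ▸ henergy x hx, hpos x hx⟩, hmono, hL⟩
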